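/- arXiv:1908.05982 — 3 statements merged into one kernel-verified Lean document; each statement's English description precedes it below -/
import Mathlib

section
/- Let H_0, …, H_n be real Hilbert spaces with H_n = H_0, W_i : H_{i-1} → H_i bounded linear operators, b_i ∈ H_i, and σ_i : H_i → H_i nonexpansive maps that additionally satisfy ‖σ_i(x)‖ ≤ ‖x‖ for all x ∈ H_i. Assume ‖W‖ := max_{i=1,…,n} ‖W_i‖ < 1. Then the unique element x^F = (x_1^F, …, x_n^F) of the trajectory set F satisfies ‖x^F‖ ≤ ‖b‖ / (1 − ‖W‖), where ‖x^F‖ = (∑_{i=1}^n ‖x_i^F‖²)^{1/2} and ‖b‖ = (∑_{i=1}^n ‖b_i‖²)^{1/2} are the norms in the Hilbert product space H_1 × ⋯ × H_n. -/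
/-!
Setting: real Hilbert spaces `H 0, H 1, …, H (n-1)` indexed cyclically by `ZMod n`,
so that `H n = H 0`.  For each `i`, `W i : H (i-1) →L[ℝ] H i` is a bounded linear
operator, `b i ∈ H i` a bias, `σ i : H i → H i` a nonexpansive activation with
`‖σ i x‖ ≤ ‖x‖`, and the `i`-th layer is `g i x = σ i (W i x + b i)`.  The product
space `H 1 × ⋯ × H n` carries the Hilbert norm `‖x‖ = (∑ i ‖x i‖²)^(1/2)`.
-/

/-- A nonnegative family `u` with `u i ≤ w * u (π i) + v i`, where `π` is a permutation and
`0 ≤ w < 1`, has `ℓ²` norm at most that of `v` divided by `1 - w`. -/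
theorem sqrt_sum_sq_le_div_of_le_mul_perm_add {ι : Type*} [Fintype ι] (π : Equiv.Perm ι)
    {u v : ι → ℝ} {w : ℝ} (hw0 : 0 ≤ w) (hw1 : w < 1) (hu : ∀ i, 0 ≤ u i)
    (h : ∀ i, u i ≤ w * u (π i) + v i) :
    √(∑ i, u i ^ 2) ≤ √(∑ i, v i ^ 2) / (1 - w) := by
  have hsum : ∑ i, u i ^ 2 ≤ w * ∑ i, u i * u (π i) + ∑ i, u i * v i := by
    rw [Finset.mul_sum, ← Finset.sum_add_distrib]
    exact Finset.sum_le_sum fun i _ => by nlinarith [mul_le_mul_of_nonneg_left (h i) (hu i)]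
  have hperm : ∑ i, u (π i) ^ 2 = ∑ i, u i ^ 2 := Equiv.sum_comp π (fun i => u i ^ 2)
  have huu := Real.sum_mul_le_sqrt_mul_sqrt Finset.univ u (fun i => u (π i))
  have huv := Real.sum_mul_le_sqrt_mul_sqrt Finset.univ u v
  have hsq : √(∑ i, u i ^ 2) * √(∑ i, u i ^ 2) = ∑ i, u i ^ 2 :=
    Real.mul_self_sqrt (Finset.sum_nonneg fun i _ => sq_nonneg (u i))
  rw [hperm] at huu
  rw [le_div_iff₀ (sub_pos.2 hw1)]
  rcases (Real.sqrt_nonneg (∑ i, u i ^ 2)).eq_or_lt with h0 | hpos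
  · rw [← h0, zero_mul]
    exact Real.sqrt_nonneg _
  · refine le_of_mul_le_mul_left ?_ hpos
    nlinarith [mul_le_mul_of_nonneg_left huu hw0]

/-- Assume every activation `σ i` is nonexpansive with
`‖σ i x‖ ≤ ‖x‖`, and `‖W‖ := max_i ‖W i‖ < 1`.  Then the unique element `e` of the
trajectory set `F` satisfies `‖e‖ ≤ ‖b‖ / (1 - ‖W‖)`, where
`‖e‖ = (∑ i ‖e i‖²)^(1/2)` and `‖b‖ = (∑ i ‖b i‖²)^(1/2)` are the Hilbert product
norms. -/
theorem trajectory_norm_bound {n : ℕ} [NeZero n]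
    (H : ZMod n → Type*) [∀ i, NormedAddCommGroup (H i)]
    [∀ i, InnerProductSpace ℝ (H i)] [∀ i, CompleteSpace (H i)]
    (W : ∀ i : ZMod n, H (i - 1) →L[ℝ] H i) (b : ∀ i : ZMod n, H i)
    (σ : ∀ i : ZMod n, H i → H i)
    (hσ : ∀ i : ZMod n, ∀ x y : H i, ‖σ i x - σ i y‖ ≤ ‖x - y‖)
    (hσ0 : ∀ i : ZMod n, ∀ x : H i, ‖σ i x‖ ≤ ‖x‖)
    (hW : Finset.univ.sup' ⟨0, Finset.mem_univ 0⟩ (fun i : ZMod n => ‖W i‖) < 1)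
    (e : ∀ i : ZMod n, H i)
    (he : ∀ i : ZMod n, e i = σ i (W i (e (i - 1)) + b i)) :
    Real.sqrt (∑ i : ZMod n, ‖e i‖ ^ 2) ≤
      Real.sqrt (∑ i : ZMod n, ‖b i‖ ^ 2) /
        (1 - Finset.univ.sup' ⟨0, Finset.mem_univ 0⟩ (fun i : ZMod n => ‖W i‖)) := by
  have hle : ∀ i, ‖W i‖ ≤ Finset.univ.sup' ⟨0, Finset.mem_univ 0⟩ (fun i : ZMod n => ‖W i‖) :=
    fun i => Finset.le_sup' (fun i : ZMod n => ‖W i‖) (Finset.mem_univ i)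
  refine sqrt_sum_sq_le_div_of_le_mul_perm_add (Equiv.subRight 1) ((norm_nonneg _).trans (hle 0))
    hW (fun i => norm_nonneg (e i)) fun i => ?_
  calc ‖e i‖ = ‖σ i (W i (e (i - 1)) + b i)‖ := congrArg norm (he i)
    _ ≤ ‖W i (e (i - 1)) + b i‖ := hσ0 i _
    _ ≤ ‖W i (e (i - 1))‖ + ‖b i‖ := norm_add_le _ _
    _ ≤ _ := by
      gcongr
      exact (W i).le_of_opNorm_le (hle i) _
end

section
/- Let H_0, …, H_n be real Hilbert spaces with H_n = H_0, W_i : H_{i-1} → H_i bounded linear operators, b_i ∈ H_i, and σ_i : H_i → H_i nonexpansive maps satisfying ‖σ_i(x)‖ ≤ ‖x‖ for all x, and assume ‖W‖ := max_{i=1,…,n} ‖W_i‖ < 1. Then the unique fixed point x̄ ∈ H_0 of the network g = g_n ∘ ⋯ ∘ g_1 satisfies ‖x̄‖ ≤ ‖b‖ / (1 − ‖W‖), where ‖b‖ = (∑_{i=1}^n ‖b_i‖²)^{1/2}. -/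
/-!
Setting: real Hilbert spaces `H 0, H 1, …, H (n-1)` indexed cyclically by `ZMod n`,
so that `H n = H 0`.  For each `i`, `W i : H (i-1) →L[ℝ] H i` is a bounded linear
operator, `b i ∈ H i` a bias, `σ i : H i → H i` a nonexpansive activation, and the
`i`-th layer is `g i x = σ i (W i x + b i)`.  The network is `g = g_n ∘ ⋯ ∘ g_1`.
-/

/-- Partial composition `g_k ∘ ⋯ ∘ g_1 : H 0 → H k` of the layers of a network whose
spaces are indexed cyclically by `ZMod n` (so that `H n = H 0`). -/
def NeuralNet.partialComp {n : ℕ} [NeZero n] (H : ZMod n → Type*)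
    (g : ∀ i : ZMod n, H (i - 1) → H i) : ∀ k : ℕ, H 0 → H ((k : ℕ) : ZMod n)
  | 0 => fun x => _root_.cast (congrArg H (by push_cast; ring)) x
  | (k + 1) => fun x =>
      g ((k + 1 : ℕ) : ZMod n)
        (_root_.cast (congrArg H (by push_cast; ring)) (NeuralNet.partialComp H g k x))

/-- The `n`-layer network `g = g_n ∘ ⋯ ∘ g_1 : H 0 → H 0` (using `H n = H 0`). -/
def NeuralNet.network {n : ℕ} [NeZero n] (H : ZMod n → Type*)
    (g : ∀ i : ZMod n, H (i - 1) → H i) : H 0 → H 0 :=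
  fun x => _root_.cast (congrArg H (ZMod.natCast_self n)) (NeuralNet.partialComp H g n x)

open Finset in
/-- A nonnegative `n`-periodic solution of `a (k + 1) ≤ w * a k + β k` with `w < 1` is bounded
in the Euclidean norm over one period, in particular at its starting point. -/
theorem Real.le_sqrt_div_of_le_mul_add_of_eq {n : ℕ} (hn : 0 < n) {a β : ℕ → ℝ} {w : ℝ}
    (ha : ∀ k, 0 ≤ a k) (hw : 0 ≤ w) (hw1 : w < 1)
    (hstep : ∀ k, a (k + 1) ≤ w * a k + β k) (hper : a n = a 0) :
    a 0 ≤ √(∑ k ∈ range n, β k ^ 2) / (1 - w) := by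
  have hshift : ∑ k ∈ range n, a (k + 1) ^ 2 = ∑ k ∈ range n, a k ^ 2 := by
    have h := sum_range_succ' (fun k => a k ^ 2) n
    rw [sum_range_succ, hper] at h
    linarith
  set A := ∑ k ∈ range n, a k ^ 2 with hA
  set B := ∑ k ∈ range n, β k ^ 2 with hB
  have hA0 : 0 ≤ A := sum_nonneg fun _ _ => sq_nonneg _
  have hB0 : 0 ≤ B := sum_nonneg fun _ _ => sq_nonneg _
  have hcs : ∑ k ∈ range n, a k * β k ≤ √A * √B := Real.sum_mul_le_sqrt_mul_sqrt _ _ _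
  have hsq : A ≤ (w * √A + √B) ^ 2 :=
    calc A = ∑ k ∈ range n, a (k + 1) ^ 2 := hshift.symm
      _ ≤ ∑ k ∈ range n, (w * a k + β k) ^ 2 :=
        sum_le_sum fun k _ => pow_le_pow_left₀ (ha _) (hstep k) 2
      _ = w ^ 2 * A + 2 * w * ∑ k ∈ range n, a k * β k + B := by
        rw [hA, hB, mul_sum, mul_sum, ← sum_add_distrib, ← sum_add_distrib]
        exact sum_congr rfl fun _ _ => by ring
      _ ≤ w ^ 2 * A + 2 * w * (√A * √B) + B := by gcongr
      _ = (w * √A + √B) ^ 2 := by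
        rw [add_sq, mul_pow, Real.sq_sqrt hA0, Real.sq_sqrt hB0]
        ring
  have hroot : √A ≤ w * √A + √B := (Real.sqrt_le_left (by positivity)).2 hsq
  have h0 : a 0 ≤ √A := Real.le_sqrt_of_sq_le <|
    single_le_sum (f := fun k => a k ^ 2) (fun _ _ => sq_nonneg _) (mem_range.2 hn)
  rw [le_div_iff₀ (sub_pos.2 hw1)]
  calc a 0 * (1 - w) ≤ √A * (1 - w) := mul_le_mul_of_nonneg_right h0 (sub_pos.2 hw1).le
    _ ≤ √B := by linarith

/-- A sum over `ZMod n` is the sum over the residues `1, …, n`. -/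
theorem ZMod.sum_eq_sum_range_add_one {M : Type*} [AddCommMonoid M] {n : ℕ} [NeZero n]
    (f : ZMod n → M) :
    ∑ i, f i = ∑ k ∈ Finset.range n, f ((k + 1 : ℕ) : ZMod n) := by
  rw [← Equiv.sum_comp (Equiv.addRight (1 : ZMod n)) f]
  refine Finset.sum_bij' (fun i _ => i.val) (fun k _ => (k : ZMod n)) ?_ ?_ ?_ ?_ ?_
  · exact fun i _ => Finset.mem_range.2 (ZMod.val_lt i)
  · exact fun _ _ => Finset.mem_univ _
  · exact fun i _ => ZMod.natCast_zmod_val i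
  · exact fun k hk => ZMod.val_cast_of_lt (Finset.mem_range.1 hk)
  · intro i _
    simp

theorem norm_cast_congrArg {ι : Type*} (H : ι → Type*) [∀ i, Norm (H i)] {i j : ι}
    (h : i = j) (x : H i) : ‖_root_.cast (congrArg H h) x‖ = ‖x‖ := by
  subst h
  rfl

/-- Assume every activation `σ i` is nonexpansive with
`‖σ i x‖ ≤ ‖x‖`, and `‖W‖ := max_i ‖W i‖ < 1`.  Then the unique fixed point
`xbar ∈ H 0` of the network `g = g_n ∘ ⋯ ∘ g_1` satisfies
`‖xbar‖ ≤ ‖b‖ / (1 - ‖W‖)`, where `‖b‖ = (∑ i ‖b i‖²)^(1/2)`. -/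
theorem fixed_point_norm_bound {n : ℕ} [NeZero n]
    (H : ZMod n → Type*) [∀ i, NormedAddCommGroup (H i)]
    [∀ i, InnerProductSpace ℝ (H i)] [∀ i, CompleteSpace (H i)]
    (W : ∀ i : ZMod n, H (i - 1) →L[ℝ] H i) (b : ∀ i : ZMod n, H i)
    (σ : ∀ i : ZMod n, H i → H i)
    (hσ : ∀ i : ZMod n, ∀ x y : H i, ‖σ i x - σ i y‖ ≤ ‖x - y‖)
    (hσ0 : ∀ i : ZMod n, ∀ x : H i, ‖σ i x‖ ≤ ‖x‖)
    (hW : Finset.univ.sup' ⟨0, Finset.mem_univ 0⟩ (fun i : ZMod n => ‖W i‖) < 1)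
    (xbar : H 0)
    (hfix : NeuralNet.network H (fun i z => σ i (W i z + b i)) xbar = xbar)
    (huniq : ∀ y : H 0,
      NeuralNet.network H (fun i z => σ i (W i z + b i)) y = y → y = xbar) :
    ‖xbar‖ ≤ Real.sqrt (∑ i : ZMod n, ‖b i‖ ^ 2) /
      (1 - Finset.univ.sup' ⟨0, Finset.mem_univ 0⟩ (fun i : ZMod n => ‖W i‖)) := by
  set w := Finset.univ.sup' ⟨0, Finset.mem_univ 0⟩ (fun i : ZMod n => ‖W i‖)
  have hle : ∀ i, ‖W i‖ ≤ w := fun i =>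
    Finset.le_sup' (fun i : ZMod n => ‖W i‖) (Finset.mem_univ i)
  let a : ℕ → ℝ := fun k =>
    ‖NeuralNet.partialComp H (fun i z => σ i (W i z + b i)) k xbar‖
  have ha0 : a 0 = ‖xbar‖ := norm_cast_congrArg H Nat.cast_zero.symm xbar
  have hper : a n = a 0 := by
    rw [ha0, ← congrArg norm hfix]
    exact (norm_cast_congrArg H (ZMod.natCast_self n) _).symm
  have hstep (k : ℕ) : a (k + 1) ≤ w * a k + ‖b ((k + 1 : ℕ) : ZMod n)‖ := by
    have hk : (k : ZMod n) = ((k + 1 : ℕ) : ZMod n) - 1 := by push_cast; ring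
    have hnorm := norm_cast_congrArg H hk
      (NeuralNet.partialComp H (fun i z => σ i (W i z + b i)) k xbar)
    refine (hσ0 _ _).trans ((norm_add_le _ _).trans (add_le_add_left ?_ _))
    exact ((W _).le_of_opNorm_le (hle _) _).trans_eq (congrArg (w * ·) hnorm)
  rw [← ha0, ZMod.sum_eq_sum_range_add_one]
  exact Real.le_sqrt_div_of_le_mul_add_of_eq (NeZero.pos n) (fun _ => norm_nonneg _)
    ((norm_nonneg _).trans (hle 0)) hW hstep hper
end

section
/- Let H_0, …, H_n be real Hilbert spaces with H_n = H_0, W_i : H_{i-1} → H_i bounded linear operators, b_i ∈ H_i, and φ_i : H_i → (−∞, +∞] proper, convex, lower semicontinuous; set σ_i = prox_{φ_i} and g_i(x) = σ_i(W_i x + b_i). On the product Hilbert space H = H_1 × ⋯ × H_n, suppose the linear operator I − W∘S is monotone, where (W∘S)(x_1, …, x_n) = (W_1 x_n, W_2 x_1, …, W_n x_{n-1}); for a bounded linear operator A this means ⟨A u, u⟩ ≥ 0 for all u ∈ H with A = I − W∘S. Then the trajectory set F = {(x_1, …, x_n) ∈ H : x_1 = g_1(x_n), x_i = g_i(x_{i-1})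 for i = 2, …, n} is closed and convex. -/
open scoped RealInnerProductSpace

/-!
Setting: real Hilbert spaces `H 0, H 1, …, H (n-1)` indexed cyclically by `ZMod n`
(so `H n = H 0`), bounded linear operators `W i : H (i-1) →L[ℝ] H i`, biases
`b i ∈ H i`, proper convex lower semicontinuous `φ i : H i → (-∞, +∞]` (modelled as
`EReal`-valued, never `⊥`), and activations `σ i = prox (φ i)` characterized as
minimizers of `z ↦ φ i z + (1/2)‖x - z‖²`.  The layer is
`g i x = σ i (W i x + b i)`.  On the product space `H = H 1 × ⋯ × H n` (inner product
`⟪u, v⟫ = ∑ i ⟪u i, v i⟫`), the operator `(W ∘ S) u = (W_1 u_n, W_2 u_1, …)` has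
coordinates `((W ∘ S) u) i = W i (u (i-1))`, and monotonicity of the linear operator
`I - W ∘ S` means `⟪(I - W ∘ S) u, u⟫ ≥ 0` for all `u`.
-/

/-- A map sending each point to a minimizer of `z ↦ φ z + (1/2)‖x - z‖²`, with `φ` proper and
convex, is firmly nonexpansive. -/
lemma prox_firmly_nonexpansive {E : Type*} [NormedAddCommGroup E] [InnerProductSpace ℝ E]
    {φ : E → EReal} {σ : E → E} (hne_bot : ∀ z, φ z ≠ ⊥) (hproper : ∃ z, φ z ≠ ⊤)
    (hconvex : ∀ u v : E, ∀ a c : ℝ, 0 ≤ a → 0 ≤ c → a + c = 1 →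
      φ (a • u + c • v) ≤ (a : EReal) * φ u + (c : EReal) * φ v)
    (hσ : ∀ x z : E, φ (σ x) + ((1 / 2 * ‖x - σ x‖ ^ 2 : ℝ) : EReal) ≤
      φ z + ((1 / 2 * ‖x - z‖ ^ 2 : ℝ) : EReal)) (x y : E) :
    0 ≤ ⟪(x - σ x) - (y - σ y), σ x - σ y⟫ := by
  have hfin : ∀ x, ∃ r : ℝ, φ (σ x) = r := by
    intro x
    obtain ⟨z, hz⟩ := hproper
    lift φ z to ℝ using ⟨hz, hne_bot z⟩ with r hr
    have h := hσ x z
    rw [← hr, ← EReal.coe_add] at h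
    have htop : φ (σ x) ≠ ⊤ := by
      intro h'
      rw [h', EReal.top_add_coe] at h
      exact EReal.coe_ne_top _ (top_le_iff.mp h)
    exact ⟨_, (EReal.coe_toReal htop (hne_bot _)).symm⟩
  have key : ∀ x y : E, ∀ α β : ℝ, φ (σ x) = α → φ (σ y) = β → ∀ t : ℝ, 0 < t → t ≤ 1 →
      α + ⟪x - σ x, σ y - σ x⟫ ≤ β + t / 2 * ‖σ y - σ x‖ ^ 2 := by
    intro x y α β hα hβ t ht ht1
    have h1 := hσ x ((1 - t) • σ x + t • σ y)
    have h2 := hconvex (σ x) (σ y) (1 - t) t (by linarith) ht.le (by ring)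
    have h3 := h1.trans (add_le_add_left h2 _)
    rw [hα, hβ] at h3
    norm_cast at h3
    have h4 : x - ((1 - t) • σ x + t • σ y) = (x - σ x) - t • (σ y - σ x) := by module
    rw [h4, norm_sub_sq_real _ (t • _), inner_smul_right, norm_smul, mul_pow, Real.norm_eq_abs,
      sq_abs] at h3
    refine le_of_mul_le_mul_left ?_ ht
    linarith
  obtain ⟨α, hα⟩ := hfin x
  obtain ⟨β, hβ⟩ := hfin y
  have hsum : ⟪(x - σ x) - (y - σ y), σ x - σ y⟫ =
      -(⟪x - σ x, σ y - σ x⟫ + ⟪y - σ y, σ x - σ y⟫) := by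
    rw [inner_sub_left, ← neg_sub (σ x) (σ y), inner_neg_right]
    ring
  have hlim : ∀ t : ℝ, 0 < t → t ≤ 1 →
      -(t * ‖σ x - σ y‖ ^ 2) ≤ ⟪(x - σ x) - (y - σ y), σ x - σ y⟫ := by
    intro t ht ht1
    have h1 := key x y α β hα hβ t ht ht1
    have h2 := key y x β α hβ hα t ht ht1
    rw [norm_sub_rev (σ y)] at h1
    rw [hsum]
    linarith
  by_contra! hneg
  set D := ⟪(x - σ x) - (y - σ y), σ x - σ y⟫
  set K := ‖σ x - σ y‖ ^ 2
  have hK : 0 ≤ K := sq_nonneg _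
  have hpos : 0 < K - D := by linarith
  have h := hlim (-D / (2 * (K - D))) (by apply div_pos <;> linarith)
    (by rw [div_le_one (by linarith)]; linarith)
  have h' : -D / (2 * (K - D)) * K ≤ -D / 2 := by
    rw [div_mul_eq_mul_div, div_le_div_iff₀ (by linarith) two_pos]
    nlinarith [sq_nonneg D]
  linarith

lemma continuous_of_firmly_nonexpansive {E : Type*} [NormedAddCommGroup E]
    [InnerProductSpace ℝ E] {σ : E → E}
    (hσ : ∀ x y, 0 ≤ ⟪(x - σ x) - (y - σ y), σ x - σ y⟫) : Continuous σ := by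
  refine (LipschitzWith.of_dist_le_mul (K := 1) fun x y => ?_).continuous
  have h := hσ x y
  rw [show (x - σ x) - (y - σ y) = (x - y) - (σ x - σ y) by abel, inner_sub_left,
    real_inner_self_eq_norm_sq] at h
  have h2 := real_inner_le_norm (x - y) (σ x - σ y)
  rw [dist_eq_norm, dist_eq_norm, NNReal.coe_one, one_mul]
  by_contra! hlt
  nlinarith [norm_nonneg (x - y), norm_nonneg (σ x - σ y)]

/-- A firmly nonexpansive map is affine on segments whose endpoints give equality in the
monotonicity of `σ⁻¹ - id`. -/
lemma firmly_nonexpansive_map_combo {E : Type*} [NormedAddCommGroup E]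
    [InnerProductSpace ℝ E] {σ : E → E}
    (hσ : ∀ x y, 0 ≤ ⟪(x - σ x) - (y - σ y), σ x - σ y⟫) {x y : E}
    (hxy : ⟪(x - σ x) - (y - σ y), σ x - σ y⟫ = 0) {a c : ℝ} (ha : 0 ≤ a) (hc : 0 ≤ c)
    (hac : a + c = 1) : σ (a • x + c • y) = a • σ x + c • σ y := by
  obtain rfl : a = 1 - c := by linarith
  set m := σ ((1 - c) • x + c • y)
  set r := (1 - c) • σ x + c • σ y
  have h1 := mul_nonneg ha (hσ ((1 - c) • x + c • y) x)
  have h2 := mul_nonneg hc (hσ ((1 - c) • x + c • y) y)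
  have hid : (1 - c) * ⟪((1 - c) • x + c • y - m) - (x - σ x), m - σ x⟫ +
      c * ⟪((1 - c) • x + c • y - m) - (y - σ y), m - σ y⟫ =
      (1 - c) * c * ⟪(x - σ x) - (y - σ y), σ x - σ y⟫ - ⟪m - r, m - r⟫ := by
    simp only [r, inner_sub_left, inner_sub_right, inner_add_left, inner_add_right,
      inner_smul_left, inner_smul_right, RCLike.conj_to_real]
    rw [real_inner_comm m (σ x), real_inner_comm m (σ y), real_inner_comm (σ x) (σ y)]
    ring
  rw [hxy, mul_zero, zero_sub] at hid
  have h3 : ⟪m - r, m - r⟫ ≤ 0 := by linarith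
  exact sub_eq_zero.mp (inner_self_eq_zero.mp (h3.antisymm real_inner_self_nonneg))

/-- If the linear operator `I - W ∘ S` on the product space is
monotone, i.e. `∑ i ⟪u i - W i (u (i-1)), u i⟫ ≥ 0` for all `u`, then the trajectory
set `F = {x | ∀ i, x i = σ i (W i (x (i-1)) + b i)}` is closed and convex. -/
theorem trajectory_set_closed_convex_of_monotone {n : ℕ} [NeZero n]
    (H : ZMod n → Type*) [∀ i, NormedAddCommGroup (H i)]
    [∀ i, InnerProductSpace ℝ (H i)] [∀ i, CompleteSpace (H i)]
    (W : ∀ i : ZMod n, H (i - 1) →L[ℝ] H i) (b : ∀ i : ZMod n, H i)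
    (φ : ∀ i : ZMod n, H i → EReal)
    (hne_bot : ∀ i : ZMod n, ∀ z : H i, φ i z ≠ ⊥)
    (hproper : ∀ i : ZMod n, ∃ z : H i, φ i z ≠ ⊤)
    (hconvex : ∀ i : ZMod n, ∀ u v : H i, ∀ a c : ℝ, 0 ≤ a → 0 ≤ c → a + c = 1 →
      φ i (a • u + c • v) ≤ (a : EReal) * φ i u + (c : EReal) * φ i v)
    (hlsc : ∀ i : ZMod n, LowerSemicontinuous (φ i))
    (σ : ∀ i : ZMod n, H i → H i)
    (hσ : ∀ i : ZMod n, ∀ x z : H i,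
      φ i (σ i x) + ((1 / 2 * ‖x - σ i x‖ ^ 2 : ℝ) : EReal) ≤
        φ i z + ((1 / 2 * ‖x - z‖ ^ 2 : ℝ) : EReal))
    (hmono : ∀ u : ∀ i : ZMod n, H i,
      0 ≤ ∑ i : ZMod n, (⟪u i - W i (u (i - 1)), u i⟫ : ℝ)) :
    IsClosed {x : ∀ i : ZMod n, H i | ∀ i : ZMod n, x i = σ i (W i (x (i - 1)) + b i)} ∧
    Convex ℝ {x : ∀ i : ZMod n, H i | ∀ i : ZMod n, x i = σ i (W i (x (i - 1)) + b i)} := by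
  have hfirm : ∀ i x y, 0 ≤ ⟪(x - σ i x) - (y - σ i y), σ i x - σ i y⟫ := fun i =>
    prox_firmly_nonexpansive (hne_bot i) (hproper i) (hconvex i) (hσ i)
  constructor
  · rw [Set.ofPred_forall]
    refine isClosed_iInter fun i => isClosed_eq (continuous_apply i) ?_
    have hcont := continuous_of_firmly_nonexpansive (hfirm i)
    exact hcont.comp (((W i).continuous.comp (continuous_apply (i - 1))).add continuous_const)
  · intro x hx y hy a c ha hc hac i
    have hterm : ∀ j, ⟪(x - y) j - W j ((x - y) (j - 1)), (x - y) j⟫ ≤ 0 := by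
      intro j
      have h := hfirm j (W j (x (j - 1)) + b j) (W j (y (j - 1)) + b j)
      rw [← hx j, ← hy j] at h
      rw [← neg_nonneg, ← inner_neg_left]
      convert h using 2
      · simp only [Pi.sub_apply, map_sub]
        abel
      · rfl
    have hzero := (Finset.sum_eq_zero_iff_of_nonpos fun j _ => hterm j).mp
      ((Finset.sum_nonpos fun j _ => hterm j).antisymm (hmono (x - y))) i (Finset.mem_univ i)
    have hcombo := firmly_nonexpansive_map_combo (hfirm i) (x := W i (x (i - 1)) + b i)
      (y := W i (y (i - 1)) + b i) (by
        rw [← hx i, ← hy i, ← neg_eq_zero, ← inner_neg_left, ← hzero]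
        congr 1
        simp only [Pi.sub_apply, map_sub]
        abel) ha hc hac
    rw [← hx i, ← hy i] at hcombo
    rw [Pi.add_apply, Pi.smul_apply, Pi.smul_apply, ← hcombo]
    congr 1
    obtain rfl : a = 1 - c := by linarith
    simp only [Pi.add_apply, Pi.smul_apply, map_add, map_smul]
    module
end
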